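/- Description of the Kirillov space: let d be a positive integer. Then S̃_d is exactly the set of functions f, smooth on ℝ ∖ {0}, such that (i) f and all its derivatives are rapidly decreasing at ±∞; (ii) y ↦ |y|^{(d−1)/2} f(y) is smooth on the right and on the left at y = 0; and (iii) y ↦ |y|^{(d−1)/2} f(y) extends to a function of class C^{d−1} on ℝ (for d = 1 this means it extends continuously). -/

import Mathlib

open MeasureTheory Set

/-- Membership in the space `I_d`: `φ` is smooth on `ℝ` and the function
`x ↦ x^{-d-1} φ(-1/x)` (defined for `x ≠ 0`) extends to a smooth function on `ℝ`. -/
def MemI (d : ℕ) (φ : ℝ → ℂ) : Prop :=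
  ContDiff ℝ (⊤ : ℕ∞) φ ∧
    ∃ ψ : ℝ → ℂ, ContDiff ℝ (⊤ : ℕ∞) ψ ∧ ∀ x : ℝ, x ≠ 0 → ψ x = ((x : ℂ) ^ (d + 1))⁻¹ * φ (-1 / x)

/-- The normalized Fourier transform `φ̂(y) = (2π)^{-1/2} ∫_ℝ φ(x) e^{-ixy} dx`. -/
noncomputable def fourierHat (φ : ℝ → ℂ) (y : ℝ) : ℂ :=
  (((2 * Real.pi) ^ (-(1 : ℝ) / 2) : ℝ) : ℂ) * ∫ x : ℝ, φ x * Complex.exp (-(Complex.I * x * y))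

/-- The operator `M_d(φ)(y) = |y|^{(1-d)/2} φ̂(y)`. -/
noncomputable def Md (d : ℕ) (φ : ℝ → ℂ) (y : ℝ) : ℂ :=
  ((|y| ^ ((1 - (d : ℝ)) / 2) : ℝ) : ℂ) * fourierHat φ y

/-- Membership in `S̃_d = M_d(I_d)`, viewed as functions on `ℝ ∖ {0}`:
`f` agrees with `M_d(φ)` away from `0` for some `φ ∈ I_d`. -/
def MemStilde (d : ℕ) (f : ℝ → ℂ) : Prop :=
  ∃ φ : ℝ → ℂ, MemI d φ ∧ ∀ y : ℝ, y ≠ 0 → f y = Md d φ y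

open Filter Topology
open scoped ContDiff

theorem HasCompactSupport.iteratedDeriv_real {h : ℝ → ℂ} (hc : HasCompactSupport h) (n : ℕ) :
    HasCompactSupport (iteratedDeriv n h) := by
  induction n with
  | zero => simpa
  | succ n ih => rw [iteratedDeriv_succ]; exact ih.deriv

/-- The derivatives of a compactly supported smooth function are bounded. -/
theorem exists_bound_iteratedDeriv {h : ℝ → ℂ} (hs : ContDiff ℝ ∞ h)
    (hc : HasCompactSupport h) (n : ℕ) : ∃ M, ∀ x, ‖iteratedDeriv n h x‖ ≤ M := by
  have hcont : Continuous (iteratedDeriv n h) :=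
    hs.continuous_iteratedDeriv n (by exact_mod_cast le_top)
  exact (hc.iteratedDeriv_real n).exists_bound_of_continuous hcont

/-- Borel's lemma: a smooth function with prescribed derivatives at `0`. -/
theorem exists_contDiff_iteratedDeriv_zero_eq (c : ℕ → ℂ) :
    ∃ B : ℝ → ℂ, ContDiff ℝ ∞ B ∧ HasCompactSupport B ∧ ∀ n, iteratedDeriv n B 0 = c n := by
  let χ : ContDiffBump (0 : ℝ) := ⟨1, 2, one_pos, one_lt_two⟩
  have hχs : ContDiff ℝ ∞ (fun x : ℝ => ((χ x : ℝ) : ℂ)) :=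
    Complex.ofRealCLM.contDiff.comp χ.contDiff
  have hχc : HasCompactSupport (fun x : ℝ => ((χ x : ℝ) : ℂ)) :=
    χ.hasCompactSupport.comp_left Complex.ofReal_zero
  have hχ1 : ∀ l : ℝ, ∀ᶠ x : ℝ in 𝓝 0, ((χ (l * x) : ℝ) : ℂ) = 1 := by
    intro l
    have h1 : Tendsto (fun x : ℝ => l * x) (𝓝 0) (𝓝 0) := by
      have : Continuous (fun x : ℝ => l * x) := by fun_prop
      simpa using this.tendsto 0
    filter_upwards [h1.eventually χ.eventuallyEq_one] with x hx
    simp only [Pi.one_apply] at hx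
    rw [hx]; simp
  have hpow : ∀ k : ℕ, ContDiff ℝ ∞ (fun x : ℝ => ((x : ℂ)) ^ k) := fun k =>
    Complex.ofRealCLM.contDiff.pow k
  let h : ℕ → ℝ → ℂ := fun k x => (x : ℂ) ^ k * ((χ x : ℝ) : ℂ)
  have hhs : ∀ k, ContDiff ℝ ∞ (h k) := fun k => (hpow k).mul hχs
  have hhc : ∀ k, HasCompactSupport (h k) := fun k => hχc.mul_left
  choose M hM using fun k n => exists_bound_iteratedDeriv (hhs k) (hhc k) n
  have hM0 : ∀ k n, 0 ≤ M k n := fun k n => (norm_nonneg _).trans (hM k n 0)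
  let a : ℕ → ℂ := fun k => c k / (k.factorial : ℂ)
  let Λ : ℕ → ℝ := fun k => 1 + 2 ^ k * (‖a k‖ * ∑ n ∈ Finset.range k, M k n)
  have hΛ : ∀ k, 1 ≤ Λ k := fun k => by
    have : 0 ≤ ∑ n ∈ Finset.range k, M k n := Finset.sum_nonneg fun n _ => hM0 k n
    simp only [Λ, le_add_iff_nonneg_right]; positivity
  let F : ℕ → ℝ → ℂ := fun k x => a k * ((x : ℂ) ^ k * ((χ (Λ k * x) : ℝ) : ℂ))
  have hFh : ∀ k, F k = fun x => (a k * ((Λ k : ℂ) ^ k)⁻¹) * h k (Λ k * x) := by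
    intro k; ext x
    have : (Λ k : ℂ) ≠ 0 := by exact_mod_cast (zero_lt_one.trans_le (hΛ k)).ne'
    simp only [F, h]; push_cast; field_simp; ring
  have hFs : ∀ k, ContDiff ℝ ∞ (F k) := fun k => by
    rw [hFh]
    exact contDiff_const.mul ((hhs k).comp (contDiff_const.mul contDiff_id))
  have hFd : ∀ k n x, iteratedDeriv n (F k) x =
      (a k * ((Λ k : ℂ) ^ k)⁻¹) * ((Λ k : ℂ) ^ n * iteratedDeriv n (h k) (Λ k * x)) := by
    intro k n x
    rw [hFh, iteratedDeriv_const_mul_field]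
    have := congrFun (iteratedDeriv_comp_const_smul (n := n) (f := h k)
      ((hhs k).of_le (by exact_mod_cast le_top)) (Λ k)) x
    rw [this]
    simp [Complex.real_smul]
  have hFb : ∀ k n, n < k → ∀ x, ‖iteratedDeriv n (F k) x‖ ≤ (1 / 2) ^ k := by
    intro k n hn x
    have hL := hΛ k
    have hL0 : 0 < Λ k := zero_lt_one.trans_le hL
    have hS : M k n ≤ ∑ n ∈ Finset.range k, M k n :=
      Finset.single_le_sum (fun n _ => hM0 k n) (Finset.mem_range.2 hn)
    have h1 : (Λ k) ^ n * Λ k ≤ (Λ k) ^ k := by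
      rw [← pow_succ]; exact pow_le_pow_right₀ hL hn
    have h2 : 2 ^ k * (‖a k‖ * M k n) ≤ Λ k := by
      have : 2 ^ k * (‖a k‖ * M k n) ≤ 2 ^ k * (‖a k‖ * ∑ n ∈ Finset.range k, M k n) := by
        gcongr
      simp only [Λ]; linarith
    rw [hFd]
    simp only [norm_mul, norm_inv, norm_pow, Complex.norm_real, Real.norm_eq_abs, abs_of_pos hL0]
    have h3 := hM k n (Λ k * x)
    calc ‖a k‖ * (Λ k ^ k)⁻¹ * (Λ k ^ n * ‖iteratedDeriv n (h k) (Λ k * x)‖)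
        ≤ ‖a k‖ * (Λ k ^ k)⁻¹ * (Λ k ^ n * M k n) := by gcongr
      _ ≤ ‖a k‖ * (Λ k ^ n * Λ k)⁻¹ * (Λ k ^ n * M k n) := by
          have := hM0 k n
          gcongr
      _ = (‖a k‖ * M k n) / Λ k := by field_simp
      _ ≤ (1 / 2) ^ k := by
        rw [div_le_iff₀ hL0, one_div, inv_pow, inv_mul_eq_div, le_div_iff₀ (by positivity)]
        linarith
  have hFall : ∀ k n, ∃ K, ∀ x, ‖iteratedDeriv n (F k) x‖ ≤ K := by
    intro k n
    refine ⟨‖a k * ((Λ k : ℂ) ^ k)⁻¹‖ * (‖(Λ k : ℂ) ^ n‖ * M k n), fun x => ?_⟩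
    rw [hFd, norm_mul, norm_mul (_ ^ n)]
    gcongr
    exact hM _ _ _
  choose K hK using hFall
  let v : ℕ → ℕ → ℝ := fun n k => if n < k then (1 / 2) ^ k else K k n
  have hv : ∀ n : ℕ, ((n : ℕ) : ℕ∞) ≤ ⊤ → Summable (v n) := by
    intro n _
    refine (summable_geometric_two).congr_cofinite ?_
    rw [Nat.cofinite_eq_atTop]
    filter_upwards [eventually_gt_atTop n] with k hk
    simp [v, hk]
  have hb : ∀ (n k : ℕ) (x : ℝ), ((n : ℕ) : ℕ∞) ≤ ⊤ → ‖iteratedFDeriv ℝ n (F k) x‖ ≤ v n k := by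
    intro n k x _
    rw [norm_iteratedFDeriv_eq_norm_iteratedDeriv]
    simp only [v]
    split_ifs with hnk
    · exact hFb k n hnk x
    · exact hK k n x
  have hGs : ContDiff ℝ ∞ (fun x => ∑' k, F k x) := contDiff_tsum hFs hv hb
  have hG : ∀ n, iteratedDeriv n (fun x => ∑' k, F k x) 0 = c n := by
    intro n
    have hF0 : ∀ k, iteratedDeriv n (F k) 0 = if k = n then c n else 0 := by
      intro k
      have he : F k =ᶠ[𝓝 0] fun x : ℝ => a k * (x : ℂ) ^ k := by
        filter_upwards [hχ1 (Λ k)] with x hx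
        simp only [F, hx, mul_one]
      have h4 : ∀ n k : ℕ, iteratedDeriv n (fun x : ℝ => (x : ℂ) ^ k) =
          fun x : ℝ => (k.descFactorial n : ℂ) * (x : ℂ) ^ (k - n) := by
        intro n k
        induction n with
        | zero => simp
        | succ n ih =>
          rw [iteratedDeriv_succ, ih]
          ext x
          have := (((hasDerivAt_id (x : ℂ)).pow (k - n)).const_mul
            (k.descFactorial n : ℂ)).comp_ofReal
          simp only [id] at this
          rw [show (fun x : ℝ => (k.descFactorial n : ℂ) * (x : ℂ) ^ (k - n)) = fun x : ℝ =>
            ((fun y : ℂ => (k.descFactorial n : ℂ) * y ^ (k - n)) x) from rfl]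
          refine (this.deriv).trans ?_
          rw [Nat.descFactorial_succ, Nat.sub_sub]
          push_cast; ring
      rw [he.iteratedDeriv_eq, iteratedDeriv_const_mul_field, h4]
      have hk0 : (k.factorial : ℂ) ≠ 0 := by exact_mod_cast k.factorial_ne_zero
      rcases lt_trichotomy k n with hkn | rfl | hkn
      · simp [Nat.descFactorial_of_lt hkn, hkn.ne]
      · simp only [Nat.descFactorial_self, a]; field_simp; simp
      · simp [hkn.ne', (Nat.sub_pos_of_lt hkn).ne']
    rw [iteratedDeriv_eq_iteratedFDeriv, iteratedFDeriv_tsum_apply hFs hv hb le_top,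
      ContinuousMultilinearMap.tsum_eval]
    · simp_rw [← iteratedDeriv_eq_iteratedFDeriv, hF0]
      simp
    · exact Summable.of_norm_bounded (hv n le_top) fun k => hb n k 0 le_top
  refine ⟨fun x => (∑' k, F k x) * ((χ x : ℝ) : ℂ), hGs.mul hχs, hχc.mul_left, fun n => ?_⟩
  rw [← hG n]
  refine EventuallyEq.iteratedDeriv_eq n ?_
  filter_upwards [hχ1 1] with x hx
  rw [one_mul] at hx
  rw [hx, mul_one]

theorem ContDiff.deriv_infty {h : ℝ → ℂ} (hs : ContDiff ℝ ∞ h) : ContDiff ℝ ∞ (deriv h) :=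
  (contDiff_infty_iff_deriv.1 hs).2

theorem ContDiff.iteratedDeriv_infty {h : ℝ → ℂ} (hs : ContDiff ℝ ∞ h) (n : ℕ) :
    ContDiff ℝ ∞ (iteratedDeriv n h) := by
  induction n with
  | zero => simpa
  | succ n ih => rw [iteratedDeriv_succ]; exact ih.deriv_infty

theorem iteratedDeriv_ofReal_mul {v : ℝ → ℂ} (hv : ContDiff ℝ ∞ v) (n : ℕ) :
    iteratedDeriv n (fun t : ℝ => (t : ℂ) * v t) =
      fun t : ℝ => (t : ℂ) * iteratedDeriv n v t + n * iteratedDeriv (n - 1) v t := by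
  induction n with
  | zero => simp
  | succ n ih =>
    rw [iteratedDeriv_succ, ih]
    ext t
    have hd : ∀ k, HasDerivAt (iteratedDeriv k v) (iteratedDeriv (k + 1) v t) t := fun k => by
      rw [iteratedDeriv_succ]
      exact ((hv.iteratedDeriv_infty k).differentiable (by simp) t).hasDerivAt
    have h1 : HasDerivAt (fun t : ℝ => (t : ℂ)) 1 t := (hasDerivAt_id t).ofReal_comp
    have h2 := (h1.mul (hd n)).add ((hd (n - 1)).const_mul (n : ℂ))
    refine h2.deriv.trans ?_
    cases n with
    | zero => simp [add_comm]
    | succ m => simp only [Nat.add_sub_cancel]; push_cast; ring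

/-- The half-line Fourier integral `∫_0^∞ B(y) e^{ixy} dy`. -/
noncomputable def halfFourier (B : ℝ → ℂ) (x : ℝ) : ℂ :=
  ∫ y in Ioi (0 : ℝ), B y * Complex.exp (Complex.I * x * y)

theorem halfFourier_bound {B : ℝ → ℂ} (x : ℝ) :
    ‖halfFourier B x‖ ≤ ∫ y in Ioi (0 : ℝ), ‖B y‖ := by
  refine (norm_integral_le_integral_norm _).trans_eq ?_
  congr 1; ext y
  rw [norm_mul, show Complex.I * x * y = ((x * y : ℝ) : ℂ) * Complex.I by push_cast; ring,
    Complex.norm_exp_ofReal_mul_I, mul_one]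

theorem halfFourier_neg (B : ℝ → ℂ) (x : ℝ) :
    halfFourier (fun y => -B y) x = -halfFourier B x := by
  simp only [halfFourier, neg_mul, integral_neg]

theorem I_mul_halfFourier {B : ℝ → ℂ} (hB : ContDiff ℝ ∞ B) (hc : HasCompactSupport B) (x : ℝ) :
    Complex.I * x * halfFourier B x = -B 0 - halfFourier (deriv B) x := by
  have he : ContDiff ℝ ∞ (fun y : ℝ => Complex.exp (Complex.I * x * y)) :=
    (contDiff_const.mul Complex.ofRealCLM.contDiff).cexp
  have hd : ∀ y : ℝ, deriv (fun y : ℝ => B y * Complex.exp (Complex.I * x * y)) y =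
      deriv B y * Complex.exp (Complex.I * x * y) +
        Complex.I * x * (B y * Complex.exp (Complex.I * x * y)) := by
    intro y
    have h1 := (hB.differentiable (by simp) y).hasDerivAt
    have h2 : HasDerivAt (fun y : ℝ => Complex.exp (Complex.I * x * y))
        (Complex.exp (Complex.I * x * y) * (Complex.I * x * 1)) y :=
      (((hasDerivAt_id y).ofReal_comp).const_mul (Complex.I * x)).cexp
    refine (h1.mul h2).deriv.trans ?_; ring
  have hi : ∀ {E : ℝ → ℂ}, ContDiff ℝ ∞ E → HasCompactSupport E →
      IntegrableOn (fun y : ℝ => E y * Complex.exp (Complex.I * x * y)) (Ioi 0) := fun hE hEc =>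
    ((hE.mul he).continuous.integrable_of_hasCompactSupport hEc.mul_right).integrableOn
  have h := HasCompactSupport.integral_Ioi_deriv_eq ((hB.mul he).of_le (by simp))
    (hc.mul_right (f' := fun y : ℝ => Complex.exp (Complex.I * x * y))) 0
  have h' : ∫ y in Ioi (0 : ℝ), deriv (fun y : ℝ => B y * Complex.exp (Complex.I * x * y)) y =
      -B 0 := by
    refine Eq.trans h ?_
    simp
  simp_rw [hd] at h'
  rw [integral_add (hi hB.deriv_infty hc.deriv) ((hi hB hc).const_mul _),
    integral_const_mul] at h'
  rw [halfFourier, halfFourier, ← h']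
  ring

theorem hasDerivAt_halfFourier {B : ℝ → ℂ} (hB : ContDiff ℝ ∞ B) (hc : HasCompactSupport B)
    (x : ℝ) : HasDerivAt (halfFourier B) (halfFourier (fun y => Complex.I * y * B y) x) x := by
  have hcont : ∀ x : ℝ, Continuous fun y : ℝ => B y * Complex.exp (Complex.I * x * y) := fun x =>
    hB.continuous.mul (by fun_prop)
  have hB' : Continuous fun y : ℝ => Complex.I * y * B y :=
    Continuous.mul (by fun_prop) hB.continuous
  have hcont' : ∀ x : ℝ,
      Continuous fun y : ℝ => Complex.I * y * B y * Complex.exp (Complex.I * x * y) := fun x =>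
    hB'.mul (by fun_prop)
  refine (hasDerivAt_integral_of_dominated_loc_of_deriv_le
    (F := fun (x : ℝ) (y : ℝ) => B y * Complex.exp (Complex.I * x * y))
    (F' := fun (x : ℝ) (y : ℝ) => Complex.I * y * B y * Complex.exp (Complex.I * x * y))
    (bound := fun y : ℝ => ‖Complex.I * y * B y‖) (s := univ)
    univ_mem (Eventually.of_forall fun x => (hcont x).aestronglyMeasurable) ?_
    (hcont' x).aestronglyMeasurable ?_ ?_ ?_).2
  · exact ((hcont x).integrable_of_hasCompactSupport hc.mul_right).integrableOn
  · refine Eventually.of_forall fun y z _ => le_of_eq ?_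
    rw [norm_mul, show Complex.I * z * y = ((z * y : ℝ) : ℂ) * Complex.I by push_cast; ring,
      Complex.norm_exp_ofReal_mul_I, mul_one]
  · exact (hB'.norm.integrable_of_hasCompactSupport (hc.mul_left.norm)).integrableOn
  · refine Eventually.of_forall fun y z _ => ?_
    have h2 : HasDerivAt (fun z : ℝ => Complex.exp (Complex.I * z * y))
        (Complex.exp (Complex.I * z * y) * (Complex.I * 1 * y)) z :=
      ((((hasDerivAt_id z).ofReal_comp).const_mul Complex.I).mul_const (y : ℂ)).cexp
    refine (h2.const_mul (B y)).congr_deriv ?_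
    ring

theorem contDiff_ofReal_mul {B : ℝ → ℂ} (hB : ContDiff ℝ ∞ B) (c : ℂ) :
    ContDiff ℝ ∞ fun y : ℝ => c * y * B y :=
  (contDiff_const.mul Complex.ofRealCLM.contDiff).mul hB

theorem contDiff_halfFourier {B : ℝ → ℂ} (hB : ContDiff ℝ ∞ B) (hc : HasCompactSupport B) :
    ContDiff ℝ ∞ (halfFourier B) := by
  refine contDiff_infty.2 fun n => ?_
  induction n generalizing B with
  | zero =>
    exact contDiff_zero.2 (continuous_iff_continuousAt.2 fun x =>
      (hasDerivAt_halfFourier hB hc x).continuousAt)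
  | succ n ih =>
    push_cast
    refine contDiff_succ_iff_deriv.2 ⟨fun x => (hasDerivAt_halfFourier hB hc x).differentiableAt,
      by simp, ?_⟩
    rw [funext fun x => (hasDerivAt_halfFourier hB hc x).deriv]
    exact ih (contDiff_ofReal_mul hB _) hc.mul_left

/-- The half-line Fourier integral in the coordinate `-1/t` at infinity, normalized to be smooth
with value `C 0` at `t = 0`. -/
noncomputable def halfFourierInv (C : ℝ → ℂ) (t : ℝ) : ℂ :=
  C 0 + if t = 0 then 0 else halfFourier (deriv C) (-1 / t)

theorem halfFourier_neg_one_div {B : ℝ → ℂ} (hB : ContDiff ℝ ∞ B) (hc : HasCompactSupport B)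
    {t : ℝ} (ht : t ≠ 0) :
    halfFourier B (-1 / t) = -Complex.I * t * halfFourierInv B t := by
  have h := I_mul_halfFourier hB hc (-1 / t)
  have ht' : (t : ℂ) ≠ 0 := by exact_mod_cast ht
  have h2 : halfFourierInv B t = -(Complex.I * ((-1 / t : ℝ) : ℂ) * halfFourier B (-1 / t)) := by
    rw [h, halfFourierInv, if_neg ht]; ring
  rw [h2]; push_cast; field_simp; simp

theorem halfFourierInv_eq {C : ℝ → ℂ} (hC : ContDiff ℝ ∞ C) (hc : HasCompactSupport C) (t : ℝ) :
    halfFourierInv C t = C 0 + -Complex.I * (t * halfFourierInv (deriv C) t) := by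
  by_cases ht : t = 0
  · simp [halfFourierInv, ht]
  · rw [halfFourierInv, if_neg ht, halfFourier_neg_one_div hC.deriv_infty hc.deriv ht, mul_assoc]

theorem continuousAt_halfFourierInv {C : ℝ → ℂ} (hC : ContDiff ℝ ∞ C)
    (hc : HasCompactSupport C) : ContinuousAt (halfFourierInv C) 0 := by
  have hb : ∃ K, ∀ t, ‖halfFourierInv (deriv C) t‖ ≤ K := by
    refine ⟨‖deriv C 0‖ + ∫ y in Ioi (0 : ℝ), ‖deriv (deriv C) y‖, fun t => ?_⟩
    refine (norm_add_le _ _).trans ?_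
    gcongr
    split_ifs
    · simp only [norm_zero]; exact integral_nonneg fun _ => norm_nonneg _
    · exact halfFourier_bound _
  obtain ⟨K, hK⟩ := hb
  have h1 : Tendsto (fun t : ℝ => (t : ℂ) * halfFourierInv (deriv C) t) (𝓝 0) (𝓝 0) := by
    refine squeeze_zero_norm (a := fun t : ℝ => |t| * K) (fun t => ?_) ?_
    · rw [norm_mul, Complex.norm_real, Real.norm_eq_abs]
      gcongr
      exact hK t
    · have : Continuous fun t : ℝ => |t| * K := by fun_prop
      simpa using this.tendsto 0
  have h2 := (h1.const_mul (-Complex.I)).const_add (C 0)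
  rw [ContinuousAt, funext (halfFourierInv_eq hC hc)]
  simpa using h2

theorem hasDerivAt_neg_one_div {t : ℝ} (ht : t ≠ 0) :
    HasDerivAt (fun t : ℝ => -1 / t) (1 / t ^ 2) t := by
  have := (hasDerivAt_inv ht).const_mul (-1)
  simpa [div_eq_mul_inv] using this

theorem hasDerivAt_halfFourierInv {C : ℝ → ℂ} (hC : ContDiff ℝ ∞ C) (hc : HasCompactSupport C)
    (t : ℝ) : HasDerivAt (halfFourierInv C)
      (halfFourierInv (deriv fun y => -Complex.I * y * deriv C y) t) t := by
  have hE : ContDiff ℝ ∞ fun y : ℝ => -Complex.I * y * deriv C y :=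
    contDiff_ofReal_mul hC.deriv_infty _
  have hEc : HasCompactSupport fun y : ℝ => -Complex.I * y * deriv C y := hc.deriv.mul_left
  by_cases ht : t = 0
  · subst ht
    have h0 : halfFourierInv (deriv fun y => -Complex.I * y * deriv C y) 0 =
        -Complex.I * deriv C 0 := by
      have h1 : HasDerivAt (fun y : ℝ => -Complex.I * (y : ℂ)) (-Complex.I * 1) 0 :=
        ((hasDerivAt_id (0 : ℝ)).ofReal_comp).const_mul _
      have h2 := (hC.deriv_infty.differentiable (by simp) 0).hasDerivAt
      have h3 := (h1.mul h2).deriv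
      simp only [halfFourierInv, if_true, add_zero]
      refine h3.trans ?_
      simp
    rw [h0, hasDerivAt_iff_tendsto_slope_zero]
    have h3 := (continuousAt_halfFourierInv hC.deriv_infty hc.deriv).tendsto.const_mul (-Complex.I)
    have h4 : halfFourierInv (deriv C) 0 = deriv C 0 := by simp [halfFourierInv]
    rw [h4] at h3
    refine (h3.mono_left nhdsWithin_le_nhds).congr' ?_
    filter_upwards [self_mem_nhdsWithin] with s hs
    have hs' : (s : ℂ) ≠ 0 := by exact_mod_cast hs
    rw [zero_add, halfFourierInv_eq hC hc s, halfFourierInv_eq hC hc 0, Complex.real_smul]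
    push_cast; field_simp; ring
  · have h2 := (hasDerivAt_halfFourier hC.deriv_infty hc.deriv (-1 / t)).scomp t
      (hasDerivAt_neg_one_div ht)
    have h3 := h2.const_add (C 0)
    have h4 : (fun x => C 0 + (halfFourier (deriv C) ∘ fun t => -1 / t) x) =ᶠ[𝓝 t]
        halfFourierInv C := by
      filter_upwards [isOpen_ne.mem_nhds ht] with s hs
      simp [halfFourierInv, if_neg hs]
    refine (h3.congr_of_eventuallyEq h4.symm).congr_deriv ?_
    have h5 : halfFourier (fun y => Complex.I * y * deriv C y) (-1 / t) =
        -halfFourier (fun y => -Complex.I * y * deriv C y) (-1 / t) := by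
      rw [← halfFourier_neg]; congr 1; ext y; ring
    have ht' : (t : ℂ) ≠ 0 := by exact_mod_cast ht
    rw [h5, halfFourier_neg_one_div hE hEc ht, halfFourierInv_eq hE hEc, Complex.real_smul]
    push_cast; field_simp
    simp

theorem contDiff_halfFourierInv {C : ℝ → ℂ} (hC : ContDiff ℝ ∞ C) (hc : HasCompactSupport C) :
    ContDiff ℝ ∞ (halfFourierInv C) := by
  refine contDiff_infty.2 fun n => ?_
  induction n generalizing C with
  | zero =>
    exact contDiff_zero.2 (continuous_iff_continuousAt.2 fun x =>
      (hasDerivAt_halfFourierInv hC hc x).continuousAt)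
  | succ n ih =>
    push_cast
    refine contDiff_succ_iff_deriv.2
      ⟨fun x => (hasDerivAt_halfFourierInv hC hc x).differentiableAt, by simp, ?_⟩
    rw [funext fun x => (hasDerivAt_halfFourierInv hC hc x).deriv]
    exact ih (contDiff_ofReal_mul hC.deriv_infty _).deriv_infty hc.deriv.mul_left.deriv

theorem iteratedDeriv_halfFourierInv_zero {C : ℝ → ℂ} (hC : ContDiff ℝ ∞ C)
    (hc : HasCompactSupport C) (n : ℕ) :
    iteratedDeriv n (halfFourierInv C) 0 = (-Complex.I) ^ n * n.factorial * iteratedDeriv n C 0 := by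
  induction n generalizing C with
  | zero => simp [halfFourierInv]
  | succ n ih =>
    rw [funext (halfFourierInv_eq hC hc), iteratedDeriv_succ']
    have h : (deriv fun t : ℝ => C 0 + -Complex.I * (t * halfFourierInv (deriv C) t)) =
        deriv fun t : ℝ => -Complex.I * (t * halfFourierInv (deriv C) t) := by
      ext t; rw [deriv_const_add]
    rw [h, ← iteratedDeriv_succ', iteratedDeriv_const_mul_field,
      iteratedDeriv_ofReal_mul (contDiff_halfFourierInv hC.deriv_infty hc.deriv)]
    simp only [Complex.ofReal_zero, zero_mul, zero_add, Nat.add_sub_cancel]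
    rw [ih hC.deriv_infty hc.deriv, ← iteratedDeriv_succ', Nat.factorial_succ]
    push_cast; ring

theorem halfFourier_eq_pow_mul {B : ℝ → ℂ} (hB : ContDiff ℝ ∞ B) (hc : HasCompactSupport B)
    (d : ℕ) (h0 : ∀ k < d, iteratedDeriv k B 0 = 0) {t : ℝ} (ht : t ≠ 0) :
    halfFourier B (-1 / t) = (-Complex.I * t) ^ (d + 1) * halfFourierInv (iteratedDeriv d B) t := by
  induction d with
  | zero => simpa using halfFourier_neg_one_div hB hc ht
  | succ d ih =>
    rw [ih fun k hk => h0 k (by omega),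
      halfFourierInv_eq (hB.iteratedDeriv_infty d) (hc.iteratedDeriv_real d), h0 d (by omega),
      ← iteratedDeriv_succ]
    ring

theorem memI_halfFourier {B : ℝ → ℂ} (hB : ContDiff ℝ ∞ B) (hc : HasCompactSupport B)
    (d : ℕ) (h0 : ∀ k < d, iteratedDeriv k B 0 = 0) : MemI d (halfFourier B) := by
  refine ⟨contDiff_halfFourier hB hc,
    fun t => (-Complex.I) ^ (d + 1) * halfFourierInv (iteratedDeriv d B) t,
    contDiff_const.mul (contDiff_halfFourierInv (hB.iteratedDeriv_infty d)
      (hc.iteratedDeriv_real d)), fun t ht => ?_⟩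
  have ht' : (t : ℂ) ≠ 0 := by exact_mod_cast ht
  rw [halfFourier_eq_pow_mul hB hc d h0 ht, mul_pow]
  field_simp

open scoped SchwartzMap

/-- Multiplication by the coordinate, on Schwartz functions. -/
noncomputable def schwartzMulX (s : 𝓢(ℝ, ℂ)) : 𝓢(ℝ, ℂ) :=
  SchwartzMap.smulLeftCLM ℂ (fun x : ℝ => (x : ℂ)) s

theorem schwartzMulX_apply (s : 𝓢(ℝ, ℂ)) (x : ℝ) : schwartzMulX s x = x * s x :=
  SchwartzMap.smulLeftCLM_apply_apply Complex.ofRealCLM.hasTemperateGrowth s x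

theorem schwartzMulX_iterate_apply (s : 𝓢(ℝ, ℂ)) (n : ℕ) (x : ℝ) :
    (schwartzMulX^[n] s) x = (x : ℂ) ^ n * s x := by
  induction n with
  | zero => simp
  | succ n ih => rw [Function.iterate_succ_apply', schwartzMulX_apply, ih]; ring

/-- A Schwartz function in the coordinate `-1/t` at infinity, extended by `0` to `t = 0`. -/
noncomputable def schwartzInv (s : 𝓢(ℝ, ℂ)) (t : ℝ) : ℂ :=
  if t = 0 then 0 else s (-1 / t)

theorem tendsto_schwartzInv (s : 𝓢(ℝ, ℂ)) : Tendsto (schwartzInv s) (𝓝 0) (𝓝 0) := by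
  obtain ⟨K, -, hK⟩ := s.decay 1 0
  refine squeeze_zero_norm (a := fun t : ℝ => |t| * K) (fun t => ?_) ?_
  · by_cases ht : t = 0
    · simp [schwartzInv, ht]
    · have h := hK (-1 / t)
      have ht' : 0 < |t| := abs_pos.2 ht
      have h' : |t|⁻¹ * ‖s (-1 / t)‖ ≤ K := by simpa using h
      rw [schwartzInv, if_neg ht]
      rwa [inv_mul_le_iff₀ ht'] at h'
  · have : Continuous fun t : ℝ => |t| * K := by fun_prop
    simpa using this.tendsto 0

theorem hasDerivAt_schwartzInv (s : 𝓢(ℝ, ℂ)) (t : ℝ) :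
    HasDerivAt (schwartzInv s)
      (schwartzInv (schwartzMulX^[2] (SchwartzMap.derivCLM ℂ ℂ s)) t) t := by
  by_cases ht : t = 0
  · subst ht
    rw [hasDerivAt_iff_tendsto_slope_zero]
    have h := (tendsto_schwartzInv (schwartzMulX s)).neg
    rw [show schwartzInv (schwartzMulX^[2] (SchwartzMap.derivCLM ℂ ℂ s)) 0 = -0 by
      simp [schwartzInv]]
    refine (h.mono_left nhdsWithin_le_nhds).congr' ?_
    filter_upwards [self_mem_nhdsWithin] with t ht
    have ht0 : t ≠ 0 := ht
    have ht' : (t : ℂ) ≠ 0 := by exact_mod_cast ht0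
    simp only [schwartzInv, if_neg ht0, zero_add, if_true, sub_zero, schwartzMulX_apply,
      Complex.real_smul]
    push_cast; field_simp
  · have h2 := (s.hasDerivAt (-1 / t)).scomp t (hasDerivAt_neg_one_div ht)
    have h4 : (s ∘ fun t => -1 / t) =ᶠ[𝓝 t] schwartzInv s := by
      filter_upwards [isOpen_ne.mem_nhds ht] with s hs
      simp [schwartzInv, if_neg hs]
    refine (h2.congr_of_eventuallyEq h4.symm).congr_deriv ?_
    have ht' : (t : ℂ) ≠ 0 := by exact_mod_cast ht
    rw [schwartzInv, if_neg ht, schwartzMulX_iterate_apply, SchwartzMap.derivCLM_apply,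
      Complex.real_smul]
    push_cast; field_simp

theorem contDiff_schwartzInv (s : 𝓢(ℝ, ℂ)) : ContDiff ℝ ∞ (schwartzInv s) := by
  refine contDiff_infty.2 fun n => ?_
  induction n generalizing s with
  | zero =>
    exact contDiff_zero.2 (continuous_iff_continuousAt.2 fun x =>
      (hasDerivAt_schwartzInv s x).continuousAt)
  | succ n ih =>
    push_cast
    refine contDiff_succ_iff_deriv.2
      ⟨fun x => (hasDerivAt_schwartzInv s x).differentiableAt, by simp, ?_⟩
    rw [funext fun x => (hasDerivAt_schwartzInv s x).deriv]
    exact ih _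

theorem memI_schwartz (d : ℕ) (s : 𝓢(ℝ, ℂ)) : MemI d s := by
  refine ⟨s.smooth ⊤, fun t => (-1) ^ (d + 1) * schwartzInv (schwartzMulX^[d + 1] s) t,
    contDiff_const.mul (contDiff_schwartzInv _), fun t ht => ?_⟩
  beta_reduce
  rw [schwartzInv, if_neg ht, schwartzMulX_iterate_apply, ← mul_assoc, ← mul_pow]
  congr 1
  push_cast
  rw [← inv_pow]; congr 1; ring

theorem MemI.add {d : ℕ} {φ₁ φ₂ : ℝ → ℂ} (h₁ : MemI d φ₁) (h₂ : MemI d φ₂) :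
    MemI d fun x => φ₁ x + φ₂ x := by
  obtain ⟨h₁, ψ₁, hψ₁, e₁⟩ := h₁
  obtain ⟨h₂, ψ₂, hψ₂, e₂⟩ := h₂
  exact ⟨h₁.add h₂, fun x => ψ₁ x + ψ₂ x, hψ₁.add hψ₂, fun x hx => by
    beta_reduce; rw [e₁ x hx, e₂ x hx, mul_add]⟩

theorem MemI.integrable {d : ℕ} (hd : 0 < d) {φ : ℝ → ℂ} (h : MemI d φ) : Integrable φ := by
  obtain ⟨h, ψ, hψ, e⟩ := h
  obtain ⟨C, hC⟩ := (isCompact_Icc (a := (-1 : ℝ)) (b := 1)).exists_bound_of_continuousOn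
    h.continuous.continuousOn
  obtain ⟨D, hD⟩ := (isCompact_Icc (a := (-1 : ℝ)) (b := 1)).exists_bound_of_continuousOn
    hψ.continuous.continuousOn
  have hC0 : 0 ≤ C := (norm_nonneg _).trans (hC 0 (by simp))
  have hD0 : 0 ≤ D := (norm_nonneg _).trans (hD 0 (by simp))
  refine (integrable_inv_one_add_sq.const_mul (2 * (C + D))).mono'
    h.continuous.aestronglyMeasurable (Eventually.of_forall fun x => ?_)
  have hx2 : 0 < 1 + x ^ 2 := by positivity
  rw [← div_eq_mul_inv, le_div_iff₀ hx2]
  rcases le_total |x| 1 with hx | hx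
  · have h1 := hC x (abs_le.1 hx)
    have h2 : x ^ 2 ≤ 1 := by rw [← sq_abs]; exact pow_le_one₀ (abs_nonneg _) hx
    nlinarith [norm_nonneg (φ x)]
  · have hx0 : x ≠ 0 := by rintro rfl; simp at hx; linarith
    have hx1 : |(-1 / x)| ≤ 1 := by
      rw [abs_div, abs_neg, abs_one]; exact div_le_one_of_le₀ hx (abs_nonneg _)
    have h1 := hD (-1 / x) (abs_le.1 hx1)
    rw [e _ (div_ne_zero (by norm_num) hx0), show -1 / (-1 / x) = x by field_simp] at h1
    rw [norm_mul, norm_inv, norm_pow, Complex.norm_real, Real.norm_eq_abs] at h1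
    have h2 : |(-1 / x)| = |x|⁻¹ := by rw [abs_div, abs_neg, abs_one, one_div]
    rw [h2, inv_pow, inv_inv] at h1
    have h3 : x ^ 2 ≤ |x| ^ (d + 1) := by
      rw [← sq_abs]; exact pow_le_pow_right₀ hx (by omega)
    have h4 : 1 ≤ x ^ 2 := by rw [← sq_abs]; exact one_le_pow₀ hx
    nlinarith [norm_nonneg (φ x)]

/-- A smooth function whose derivatives decay rapidly at infinity is a Schwartz function. -/
theorem exists_schwartz_coe_eq {h : ℝ → ℂ} (hs : ContDiff ℝ ∞ h)
    (hdec : ∀ m n : ℕ, ∃ C : ℝ, ∀ y : ℝ, 1 ≤ |y| → |y| ^ m * ‖iteratedDeriv n h y‖ ≤ C) :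
    ∃ s : 𝓢(ℝ, ℂ), ∀ x, s x = h x := by
  refine ⟨⟨h, hs, fun m n => ?_⟩, fun x => rfl⟩
  obtain ⟨C, hC⟩ := hdec m n
  have hcont : Continuous fun y : ℝ => |y| ^ m * ‖iteratedDeriv n h y‖ :=
    (continuous_abs.pow m).mul (hs.iteratedDeriv_infty n).continuous.norm
  obtain ⟨D, hD⟩ := (isCompact_Icc (a := (-1 : ℝ)) (b := 1)).exists_bound_of_continuousOn
    hcont.continuousOn
  refine ⟨max C D, fun x => ?_⟩
  rw [norm_iteratedFDeriv_eq_norm_iteratedDeriv, Real.norm_eq_abs]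
  rcases le_total 1 |x| with hx | hx
  · exact (hC x hx).trans (le_max_left _ _)
  · exact ((Real.le_norm_self _).trans (hD x (abs_le.1 hx))).trans (le_max_right _ _)

/-- A smooth function all of whose derivatives vanish at `0` vanishes to infinite order there. -/
theorem exists_bound_of_flat {χ : ℝ → ℂ} (hs : ContDiff ℝ ∞ χ)
    (h0 : ∀ n, iteratedDeriv n χ 0 = 0) (m : ℕ) :
    ∃ C, ∀ t : ℝ, |t| ≤ 1 → ‖χ t‖ ≤ C * |t| ^ m := by
  induction m generalizing χ with
  | zero =>
    obtain ⟨C, hC⟩ := (isCompact_Icc (a := (-1 : ℝ)) (b := 1)).exists_bound_of_continuousOn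
      hs.continuous.continuousOn
    exact ⟨C, fun t ht => by simpa using hC t (abs_le.1 ht)⟩
  | succ m ih =>
    obtain ⟨C, hC⟩ := ih hs.deriv_infty fun n => by rw [← iteratedDeriv_succ']; exact h0 _
    have hC0 : 0 ≤ C := by simpa using (norm_nonneg _).trans (hC 1 (by simp))
    refine ⟨C, fun t ht => ?_⟩
    have h := Convex.norm_image_sub_le_of_norm_deriv_le (f := χ) (C := C * |t| ^ m)
      (s := Icc (-|t|) |t|) (x := 0) (y := t)
      (fun x _ => hs.differentiable (by simp) x)
      (fun x hx => (hC x ((abs_le.2 hx).trans ht)).trans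
        (mul_le_mul_of_nonneg_left (pow_le_pow_left₀ (abs_nonneg _) (abs_le.2 hx) m) hC0))
      (convex_Icc _ _) (by simp) ⟨neg_abs_le t, le_abs_self t⟩
    have h00 : χ 0 = 0 := by simpa using h0 0
    rw [h00, sub_zero, sub_zero, Real.norm_eq_abs, mul_assoc, ← pow_succ] at h
    exact h

theorem flat_ofReal_mul {χ : ℝ → ℂ} (hs : ContDiff ℝ ∞ χ)
    (h0 : ∀ n, iteratedDeriv n χ 0 = 0) (n : ℕ) :
    iteratedDeriv n (fun t : ℝ => (t : ℂ) * χ t) 0 = 0 := by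
  rw [iteratedDeriv_ofReal_mul hs]; simp [h0]

/-- If `r(x) = χ(-1/x)` with `χ` flat at `0`, then `r` is a Schwartz function. -/
theorem exists_schwartz_of_flat {r χ : ℝ → ℂ} (hr : ContDiff ℝ ∞ r) (hs : ContDiff ℝ ∞ χ)
    (h0 : ∀ n, iteratedDeriv n χ 0 = 0) (he : ∀ x : ℝ, x ≠ 0 → r x = χ (-1 / x)) :
    ∃ s : 𝓢(ℝ, ℂ), ∀ x, s x = r x := by
  have key : ∀ n : ℕ, ∃ χ' : ℝ → ℂ, ContDiff ℝ ∞ χ' ∧ (∀ n, iteratedDeriv n χ' 0 = 0) ∧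
      ∀ x : ℝ, x ≠ 0 → iteratedDeriv n r x = χ' (-1 / x) := by
    intro n
    induction n with
    | zero => exact ⟨χ, hs, h0, by simpa using he⟩
    | succ n ih =>
      obtain ⟨ξ, hξ, hξ0, hξe⟩ := ih
      have h1 : ContDiff ℝ ∞ fun t : ℝ => (t : ℂ) * deriv ξ t :=
        Complex.ofRealCLM.contDiff.mul hξ.deriv_infty
      have h1' := flat_ofReal_mul hξ.deriv_infty fun n => by
        rw [← iteratedDeriv_succ']; exact hξ0 _
      refine ⟨fun t : ℝ => (t : ℂ) * ((t : ℂ) * deriv ξ t),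
        Complex.ofRealCLM.contDiff.mul h1, flat_ofReal_mul h1 h1', fun x hx => ?_⟩
      have h2 : iteratedDeriv n r =ᶠ[𝓝 x] ξ ∘ fun x => -1 / x := by
        filter_upwards [isOpen_ne.mem_nhds hx] with z hz
        exact hξe z hz
      have h3 := ((hξ.differentiable (by simp) (-1 / x)).hasDerivAt).scomp x
        (hasDerivAt_neg_one_div hx)
      rw [iteratedDeriv_succ, h2.deriv_eq, h3.deriv, Complex.real_smul]
      push_cast; ring
  refine exists_schwartz_coe_eq hr fun m n => ?_
  obtain ⟨ξ, hξ, hξ0, hξe⟩ := key n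
  obtain ⟨C, hC⟩ := exists_bound_of_flat hξ hξ0 m
  refine ⟨C, fun y hy => ?_⟩
  have hy0 : 0 < |y| := one_pos.trans_le hy
  have h2 : |(-1 / y)| = |y|⁻¹ := by rw [abs_div, abs_neg, abs_one, one_div]
  have h3 := hC (-1 / y) (by rw [h2]; exact inv_le_one_of_one_le₀ hy)
  rw [h2, inv_pow, ← div_eq_mul_inv, le_div_iff₀ (by positivity)] at h3
  rw [hξe y (abs_pos.1 hy0), mul_comm]
  exact h3

/-- Every element of `I_d` is the sum of a Schwartz function and of a half-line Fourier
integral. -/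
theorem MemI.exists_decomposition {d : ℕ} {φ : ℝ → ℂ} (h : MemI d φ) :
    ∃ (s : 𝓢(ℝ, ℂ)) (B : ℝ → ℂ), ContDiff ℝ ∞ B ∧ HasCompactSupport B ∧
      (∀ k < d, iteratedDeriv k B 0 = 0) ∧ ∀ x, φ x = s x + halfFourier B x := by
  obtain ⟨hφ, ψ, hψ, e⟩ := h
  obtain ⟨B, hB, hc, hB0⟩ := exists_contDiff_iteratedDeriv_zero_eq fun k =>
    if k < d then 0 else iteratedDeriv (k - d) ψ 0 /
      ((-Complex.I) ^ (d + 1) * ((-Complex.I) ^ (k - d) * (k - d).factorial))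
  have h0 : ∀ k < d, iteratedDeriv k B 0 = 0 := fun k hk => by rw [hB0, if_pos hk]
  let C := iteratedDeriv d B
  have hC : ContDiff ℝ ∞ C := hB.iteratedDeriv_infty d
  have hCc : HasCompactSupport C := hc.iteratedDeriv_real d
  let u : ℝ → ℂ := fun t => (-Complex.I) ^ (d + 1) * halfFourierInv C t
  have hu : ContDiff ℝ ∞ u := contDiff_const.mul (contDiff_halfFourierInv hC hCc)
  let w : ℝ → ℂ := fun t => ψ t - u t
  have hw : ContDiff ℝ ∞ w := hψ.sub hu
  have hw0 : ∀ n, iteratedDeriv n w 0 = 0 := by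
    intro n
    have hn : ((n : ℕ) : WithTop ℕ∞) ≤ ∞ := by exact_mod_cast le_top
    have hI : (-Complex.I) ≠ 0 := neg_ne_zero.2 Complex.I_ne_zero
    have hf : (n.factorial : ℂ) ≠ 0 := by exact_mod_cast n.factorial_ne_zero
    have h1 : iteratedDeriv n C 0 = iteratedDeriv (n + d) B 0 := by
      simp only [C, iteratedDeriv_eq_iterate, Function.iterate_add_apply]
    have h2 : iteratedDeriv n w 0 = iteratedDeriv n ψ 0 - iteratedDeriv n u 0 :=
      iteratedDeriv_sub (hψ.of_le hn).contDiffAt (hu.of_le hn).contDiffAt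
    rw [h2, iteratedDeriv_const_mul_field, iteratedDeriv_halfFourierInv_zero hC hCc, h1, hB0,
      if_neg (by omega), Nat.add_sub_cancel]
    field_simp
    simp
  have hW : ContDiff ℝ ∞ fun t : ℝ => (t : ℂ) ^ (d + 1) * w t :=
    (Complex.ofRealCLM.contDiff.pow _).mul hw
  have hW0 : ∀ k n, iteratedDeriv n (fun t : ℝ => (t : ℂ) ^ k * w t) 0 = 0 := by
    intro k
    induction k with
    | zero => simpa using hw0
    | succ k ih =>
      simp_rw [pow_succ', mul_assoc]
      exact flat_ofReal_mul ((Complex.ofRealCLM.contDiff.pow _).mul hw) ih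
  obtain ⟨s, hs⟩ := exists_schwartz_of_flat (r := fun x => φ x - halfFourier B x)
    (hφ.sub (contDiff_halfFourier hB hc)) hW (hW0 _) (fun x hx => by
      have ht : -1 / x ≠ 0 := div_ne_zero (by norm_num) hx
      have hx' : (x : ℂ) ≠ 0 := by exact_mod_cast hx
      have h1 := e _ ht
      have h2 := halfFourier_eq_pow_mul hB hc d h0 ht
      rw [show -1 / (-1 / x) = x by field_simp] at h1 h2
      simp only [w, u]
      rw [h1, h2, mul_sub, mul_pow, ← mul_assoc, mul_inv_cancel₀, one_mul]
      · ring
      · exact pow_ne_zero _ (by exact_mod_cast ht))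
  exact ⟨s, B, hB, hc, h0, fun x => by rw [hs]; ring⟩

open scoped FourierTransform

theorem fourierHat_eq (φ : ℝ → ℂ) (y : ℝ) :
    fourierHat φ y = (((2 * Real.pi) ^ (-(1 : ℝ) / 2) : ℝ) : ℂ) * 𝓕 φ (y / (2 * Real.pi)) := by
  rw [fourierHat, Real.fourier_real_eq_integral_exp_smul]
  congr 2
  ext x
  have hpi : (Real.pi : ℂ) ≠ 0 := by exact_mod_cast Real.pi_ne_zero
  rw [smul_eq_mul, mul_comm]
  congr 2
  push_cast
  field_simp

theorem fourierHat_add {φ₁ φ₂ : ℝ → ℂ} (h₁ : Integrable φ₁) (h₂ : Integrable φ₂) (y : ℝ) :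
    fourierHat (fun x => φ₁ x + φ₂ x) y = fourierHat φ₁ y + fourierHat φ₂ y := by
  have hb : ∀ {φ : ℝ → ℂ}, Integrable φ →
      Integrable fun x : ℝ => φ x * Complex.exp (-(Complex.I * x * y)) := fun {φ} h => by
    refine h.mul_bdd (c := 1) (by fun_prop) (Eventually.of_forall fun x => ?_)
    rw [show -(Complex.I * x * y) = ((-(x * y) : ℝ) : ℂ) * Complex.I by push_cast; ring,
      Complex.norm_exp_ofReal_mul_I]
  simp only [fourierHat, add_mul]
  rw [integral_add (hb h₁) (hb h₂), mul_add]

theorem two_pi_rpow_ne_zero : (((2 * Real.pi) ^ (-(1 : ℝ) / 2) : ℝ) : ℂ) ≠ 0 := by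
  exact_mod_cast (Real.rpow_pos_of_pos Real.two_pi_pos _).ne'

/-- Dilation of a Schwartz function. -/
noncomputable def schwartzDilate (a : ℝ) (ha : a ≠ 0) (s : 𝓢(ℝ, ℂ)) : 𝓢(ℝ, ℂ) :=
  SchwartzMap.compCLMOfContinuousLinearEquiv ℂ
    (ContinuousLinearEquiv.unitsEquivAut ℝ (Units.mk0 a ha)) s

theorem schwartzDilate_apply (a : ℝ) (ha : a ≠ 0) (s : 𝓢(ℝ, ℂ)) (x : ℝ) :
    schwartzDilate a ha s x = s (x * a) := rfl

theorem exists_schwartz_eq_fourierHat (s : 𝓢(ℝ, ℂ)) :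
    ∃ S : 𝓢(ℝ, ℂ), ∀ y, fourierHat s y = S y := by
  refine ⟨(((2 * Real.pi) ^ (-(1 : ℝ) / 2) : ℝ) : ℂ) •
    schwartzDilate (2 * Real.pi)⁻¹ (inv_ne_zero Real.two_pi_pos.ne') (𝓕 s), fun y => ?_⟩
  rw [fourierHat_eq, smul_apply, schwartzDilate_apply, SchwartzMap.fourier_coe,
    smul_eq_mul, ← div_eq_mul_inv]

theorem exists_schwartz_fourierHat_eq (S : 𝓢(ℝ, ℂ)) :
    ∃ s : 𝓢(ℝ, ℂ), ∀ y, fourierHat s y = S y := by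
  refine ⟨𝓕⁻ ((((2 * Real.pi) ^ (-(1 : ℝ) / 2) : ℝ) : ℂ)⁻¹ •
    schwartzDilate (2 * Real.pi) Real.two_pi_pos.ne' S), fun y => ?_⟩
  rw [fourierHat_eq, ← SchwartzMap.fourier_coe, FourierTransform.fourier_fourierInv_eq,
    smul_apply, schwartzDilate_apply, smul_eq_mul,
    mul_inv_cancel_left₀ two_pi_rpow_ne_zero, div_mul_cancel₀ _ Real.two_pi_pos.ne']

theorem fourierHat_halfFourier {B : ℝ → ℂ} (hB : ContDiff ℝ ∞ B) (hc : HasCompactSupport B)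
    (h0 : B 0 = 0) (y : ℝ) :
    fourierHat (halfFourier B) y =
      (((2 * Real.pi) ^ (-(1 : ℝ) / 2) : ℝ) : ℂ) * (2 * Real.pi) * (Ioi 0).indicator B y := by
  have hI : Integrable (halfFourier B) :=
    (memI_halfFourier hB hc 1 (by simpa using h0)).integrable one_pos
  let b : ℝ → ℂ := (Ioi 0).indicator B
  have hbi : Integrable b :=
    (hB.continuous.integrable_of_hasCompactSupport hc).indicator measurableSet_Ioi
  have hbc : Continuous b := by
    refine hB.continuous.indicator fun x hx => ?_
    rw [frontier_Ioi, mem_singleton_iff] at hx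
    rw [hx, h0]
  have hexp : ∀ x : ℝ, ∫ w : ℝ, Complex.exp (Complex.I * x * w) • b w = halfFourier B x := by
    intro x
    rw [halfFourier, ← integral_indicator measurableSet_Ioi]
    congr 1; ext w
    by_cases hw : w ∈ Ioi (0 : ℝ) <;> simp [b, hw, mul_comm]
  have hF : ∀ v : ℝ, 𝓕 b v = halfFourier B ((-(2 * Real.pi)) * v) := by
    intro v
    rw [Real.fourier_real_eq_integral_exp_smul, ← hexp]
    congr 1; ext w; congr 2; push_cast; ring
  have hFi : ∀ v : ℝ, 𝓕⁻ b v = halfFourier B ((2 * Real.pi) * v) := by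
    intro v
    rw [Real.fourierInv_eq_fourier_neg, hF]; congr 1; ring
  have hFI : Integrable (𝓕 b) := by
    rw [funext hF]
    exact hI.comp_mul_left' (neg_ne_zero.2 Real.two_pi_pos.ne')
  have h := hbi.fourier_fourierInv_eq hFI (v := y) hbc.continuousAt
  rw [Real.fourier_real_eq_integral_exp_smul] at h
  simp_rw [hFi] at h
  have h2 := Measure.integral_comp_mul_left
    (fun x : ℝ => halfFourier B x * Complex.exp (-(Complex.I * x * y))) (2 * Real.pi)
  have h3 : (∫ x : ℝ, halfFourier B (2 * Real.pi * x) *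
      Complex.exp (-(Complex.I * ((2 * Real.pi * x : ℝ) : ℂ) * y))) = b y := by
    rw [← h]
    congr 1; ext x
    rw [smul_eq_mul, mul_comm]
    congr 2; push_cast; ring
  rw [h3, abs_of_pos (inv_pos.2 Real.two_pi_pos), Complex.real_smul] at h2
  have hpi : (Real.pi : ℂ) ≠ 0 := by exact_mod_cast Real.pi_ne_zero
  rw [fourierHat, mul_assoc]
  congr 1
  change _ = _ * b y
  rw [h2, ← mul_assoc]
  push_cast
  rw [mul_inv_cancel₀ (mul_ne_zero two_ne_zero hpi), one_mul]

/-- Smoothness on `ℝ ∖ {0}`. -/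
def SmoothOffZero (f : ℝ → ℂ) : Prop := ∀ y : ℝ, y ≠ 0 → ContDiffAt ℝ ∞ f y

/-- Rapid decrease at `±∞` of a function and of all its derivatives. -/
def RapidlyDecreasing (f : ℝ → ℂ) : Prop :=
  ∀ m n : ℕ, ∃ C : ℝ, ∀ y : ℝ, 1 ≤ |y| → |y| ^ m * ‖iteratedDeriv n f y‖ ≤ C

theorem SmoothOffZero.congr {f g : ℝ → ℂ} (hf : SmoothOffZero f)
    (h : ∀ y, y ≠ 0 → g y = f y) : SmoothOffZero g := fun y hy =>
  (hf y hy).congr_of_eventuallyEq (by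
    filter_upwards [isOpen_ne.mem_nhds hy] with z hz using h z hz)

theorem RapidlyDecreasing.congr {f g : ℝ → ℂ} (hf : RapidlyDecreasing f)
    (h : ∀ y : ℝ, 1 / 2 < |y| → g y = f y) : RapidlyDecreasing g := fun m n => by
  obtain ⟨C, hC⟩ := hf m n
  refine ⟨C, fun y hy => ?_⟩
  have : g =ᶠ[𝓝 y] f := by
    filter_upwards [(isOpen_lt continuous_const continuous_abs).mem_nhds
      (show 1 / 2 < |y| by linarith)] with z hz using h z hz
  rw [this.iteratedDeriv_eq]
  exact hC y hy

theorem SmoothOffZero.add {f g : ℝ → ℂ} (hf : SmoothOffZero f) (hg : SmoothOffZero g) :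
    SmoothOffZero fun y => f y + g y := fun y hy => (hf y hy).add (hg y hy)

theorem RapidlyDecreasing.add {f g : ℝ → ℂ} (hf : RapidlyDecreasing f) (hg : RapidlyDecreasing g)
    (sf : SmoothOffZero f) (sg : SmoothOffZero g) :
    RapidlyDecreasing fun y => f y + g y := fun m n => by
  obtain ⟨C, hC⟩ := hf m n
  obtain ⟨D, hD⟩ := hg m n
  refine ⟨C + D, fun y hy => ?_⟩
  have hy0 : y ≠ 0 := abs_pos.1 (one_pos.trans_le hy)
  have hn : ((n : ℕ) : WithTop ℕ∞) ≤ ∞ := by exact_mod_cast le_top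
  rw [iteratedDeriv_fun_add ((sf y hy0).of_le hn) ((sg y hy0).of_le hn)]
  calc |y| ^ m * ‖iteratedDeriv n f y + iteratedDeriv n g y‖
      ≤ |y| ^ m * (‖iteratedDeriv n f y‖ + ‖iteratedDeriv n g y‖) := by
        gcongr; exact norm_add_le _ _
    _ ≤ C + D := by rw [mul_add]; exact add_le_add (hC y hy) (hD y hy)

theorem eventually_sign_eq {y : ℝ} (hy : y ≠ 0) (a b : ℂ) :
    ∀ᶠ z in 𝓝 y, (if 0 < z then a else b) = if 0 < y then a else b := by
  rcases hy.lt_or_gt with hy | hy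
  · filter_upwards [Iio_mem_nhds hy] with z hz
    rw [if_neg (not_lt.2 (le_of_lt hz)), if_neg (not_lt.2 hy.le)]
  · filter_upwards [Ioi_mem_nhds hy] with z hz
    rw [if_pos (mem_Ioi.1 hz), if_pos hy]

theorem SmoothOffZero.sign_mul {f : ℝ → ℂ} (hf : SmoothOffZero f) (a b : ℂ) :
    SmoothOffZero fun y => (if 0 < y then a else b) * f y := fun y hy => by
  refine (contDiffAt_const (c := if 0 < y then a else b)).mul (hf y hy)
    |>.congr_of_eventuallyEq ?_
  filter_upwards [eventually_sign_eq hy a b] with z hz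
  rw [hz]

theorem RapidlyDecreasing.sign_mul {f : ℝ → ℂ} (hf : RapidlyDecreasing f) (a b : ℂ) :
    RapidlyDecreasing fun y => (if 0 < y then a else b) * f y := fun m n => by
  obtain ⟨C, hC⟩ := hf m n
  refine ⟨(‖a‖ + ‖b‖) * C, fun y hy => ?_⟩
  have hy0 : y ≠ 0 := abs_pos.1 (one_pos.trans_le hy)
  have h : (fun y => (if 0 < y then a else b) * f y) =ᶠ[𝓝 y]
      fun z => (if 0 < y then a else b) * f z := by
    filter_upwards [eventually_sign_eq hy0 a b] with z hz
    rw [hz]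
  have h2 : ‖(if 0 < y then a else b)‖ ≤ ‖a‖ + ‖b‖ := by
    split_ifs
    · exact le_add_of_nonneg_right (norm_nonneg _)
    · exact le_add_of_nonneg_left (norm_nonneg _)
  rw [h.iteratedDeriv_eq, iteratedDeriv_const_mul_field, norm_mul, mul_left_comm]
  exact mul_le_mul h2 (hC y hy) (by positivity) (by positivity)

theorem SmoothOffZero.rpow_mul {f : ℝ → ℂ} (hf : SmoothOffZero f) (a : ℝ) :
    SmoothOffZero fun y => ((|y| ^ a : ℝ) : ℂ) * f y := fun y hy =>
  (Complex.ofRealCLM.contDiff.contDiffAt.comp y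
    ((contDiffAt_abs hy).rpow_const_of_ne (abs_ne_zero.2 hy))).mul (hf y hy)

theorem SmoothOffZero.deriv {f : ℝ → ℂ} (hf : SmoothOffZero f) : SmoothOffZero (deriv f) :=
  fun y hy => ((hf y hy).fderiv_right (m := ∞) (by simp)).clm_apply contDiffAt_const

theorem SmoothOffZero.deriv_rpow_mul {f : ℝ → ℂ} (hf : SmoothOffZero f) (a : ℝ) {y : ℝ}
    (hy : y ≠ 0) : _root_.deriv (fun y => ((|y| ^ a : ℝ) : ℂ) * f y) y =
      ((|y| ^ (a - 1) : ℝ) : ℂ) * ((if 0 < y then (a : ℂ) else -a) * f y) +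
        ((|y| ^ a : ℝ) : ℂ) * _root_.deriv f y := by
  have h1 := ((hasDerivAt_abs hy).rpow_const (p := a) (Or.inl (abs_ne_zero.2 hy))).ofReal_comp
  have h2 := ((hf y hy).differentiableAt (by simp)).hasDerivAt
  refine (h1.mul h2).deriv.trans ?_
  rcases hy.lt_or_gt with hy | hy
  · rw [if_neg (not_lt.2 hy.le), sign_neg hy]; simp only [SignType.coe_neg_one]; push_cast; ring
  · rw [if_pos hy, sign_pos hy]; simp only [SignType.coe_one]; push_cast; ring

/-- Rapid decrease is preserved by multiplication by a power of `|y|`. -/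
theorem RapidlyDecreasing.rpow_mul {f : ℝ → ℂ} (hd : RapidlyDecreasing f) (hf : SmoothOffZero f)
    (a : ℝ) : RapidlyDecreasing fun y => ((|y| ^ a : ℝ) : ℂ) * f y := fun m n => by
  induction n generalizing f a with
  | zero =>
    obtain ⟨C, hC⟩ := hd (m + ⌈a⌉₊) 0
    refine ⟨C, fun y hy => le_trans ?_ (hC y hy)⟩
    have h : |y| ^ a ≤ |y| ^ ⌈a⌉₊ := by
      rw [← Real.rpow_natCast]; exact Real.rpow_le_rpow_of_exponent_le hy (Nat.le_ceil a)
    rw [iteratedDeriv_zero, iteratedDeriv_zero, norm_mul, Complex.norm_real, Real.norm_eq_abs,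
      abs_of_nonneg (Real.rpow_nonneg (abs_nonneg y) a), pow_add, mul_assoc]
    gcongr
  | succ n ih =>
    have hd' : RapidlyDecreasing (_root_.deriv f) := fun m n => by
      rw [← iteratedDeriv_succ']; exact hd m (n + 1)
    obtain ⟨C, hC⟩ := ih (hd.sign_mul a (-a)) (hf.sign_mul a (-a)) (a - 1)
    obtain ⟨D, hD⟩ := ih hd' hf.deriv a
    refine ⟨C + D, fun y hy => ?_⟩
    have hy0 : y ≠ 0 := abs_pos.1 (one_pos.trans_le hy)
    have hn : ((n : ℕ) : WithTop ℕ∞) ≤ ∞ := by exact_mod_cast le_top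
    have he : _root_.deriv (fun y => ((|y| ^ a : ℝ) : ℂ) * f y) =ᶠ[𝓝 y] fun y =>
        ((|y| ^ (a - 1) : ℝ) : ℂ) * ((if 0 < y then (a : ℂ) else -a) * f y) +
          ((|y| ^ a : ℝ) : ℂ) * _root_.deriv f y := by
      filter_upwards [isOpen_ne.mem_nhds hy0] with z hz using hf.deriv_rpow_mul a hz
    rw [iteratedDeriv_succ', he.iteratedDeriv_eq,
      iteratedDeriv_fun_add ((((hf.sign_mul a (-a)).rpow_mul (a - 1)) y hy0).of_le hn)
        (((hf.deriv.rpow_mul a) y hy0).of_le hn)]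
    refine (mul_le_mul_of_nonneg_left (norm_add_le _ _) (by positivity)).trans ?_
    rw [mul_add]
    exact add_le_add (hC y hy) (hD y hy)

theorem SchwartzMap.rapidlyDecreasing (s : 𝓢(ℝ, ℂ)) : RapidlyDecreasing s := fun m n => by
  obtain ⟨C, -, hC⟩ := s.decay m n
  refine ⟨C, fun y _ => ?_⟩
  have := hC y
  rwa [norm_iteratedFDeriv_eq_norm_iteratedDeriv, Real.norm_eq_abs] at this

theorem indicator_Ioi_eq_sign_mul (B : ℝ → ℂ) (y : ℝ) :
    (Ioi 0).indicator B y = (if 0 < y then 1 else 0) * B y := by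
  by_cases hy : 0 < y <;> simp [indicator, hy]

theorem ContDiff.smoothOffZero {B : ℝ → ℂ} (hB : ContDiff ℝ ∞ B) : SmoothOffZero B :=
  fun _ _ => hB.contDiffAt

theorem ContDiff.smoothOffZero_indicator {B : ℝ → ℂ} (hB : ContDiff ℝ ∞ B) :
    SmoothOffZero ((Ioi 0).indicator B) :=
  (hB.smoothOffZero.sign_mul 1 0).congr fun y _ => indicator_Ioi_eq_sign_mul B y

theorem HasCompactSupport.rapidlyDecreasing {B : ℝ → ℂ} (hc : HasCompactSupport B)
    (hB : ContDiff ℝ ∞ B) : RapidlyDecreasing B :=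
  (hc.toSchwartzMap hB).rapidlyDecreasing

theorem HasCompactSupport.rapidlyDecreasing_indicator {B : ℝ → ℂ} (hc : HasCompactSupport B)
    (hB : ContDiff ℝ ∞ B) : RapidlyDecreasing ((Ioi 0).indicator B) :=
  ((hc.rapidlyDecreasing hB).sign_mul 1 0).congr fun y _ => indicator_Ioi_eq_sign_mul B y

theorem contDiff_indicator_Ioi {B : ℝ → ℂ} (hB : ContDiff ℝ ∞ B) {n : ℕ}
    (h0 : ∀ k ≤ n, iteratedDeriv k B 0 = 0) : ContDiff ℝ n ((Ioi 0).indicator B) := by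
  induction n generalizing B with
  | zero =>
    refine contDiff_zero.2 (hB.continuous.indicator fun x hx => ?_)
    rw [frontier_Ioi, mem_singleton_iff] at hx
    simpa [hx] using h0 0 le_rfl
  | succ n ih =>
    have hB0 : B 0 = 0 := by simpa using h0 0 (by omega)
    have hd : ∀ x, HasDerivAt ((Ioi 0).indicator B) ((Ioi 0).indicator (deriv B) x) x := by
      intro x
      have hBx := (hB.differentiable (by simp) x).hasDerivAt
      rcases lt_trichotomy x 0 with hx | rfl | hx
      · rw [indicator_of_notMem (by simpa using hx.le)]
        refine (hasDerivAt_const x 0).congr_of_eventuallyEq ?_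
        filter_upwards [Iio_mem_nhds hx] with z hz
        exact indicator_of_notMem (by simpa using le_of_lt hz) _
      · have h1 : deriv B 0 = 0 := by simpa using h0 1 (by omega)
        rw [h1] at hBx
        rw [indicator_of_notMem (by simp), ← hasDerivWithinAt_univ, ← Iic_union_Ici (a := (0 : ℝ))]
        refine ((hasDerivWithinAt_const 0 _ 0).congr (fun z hz => ?_) (by simp)).union
          (hBx.hasDerivWithinAt.congr (fun z hz => ?_) (by simp [hB0]))
        · exact indicator_of_notMem (by simpa using hz) _
        · rcases eq_or_lt_of_le (mem_Ici.1 hz) with rfl | hz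
          · simp [hB0]
          · exact indicator_of_mem hz _
      · rw [indicator_of_mem (mem_Ioi.2 hx)]
        refine hBx.congr_of_eventuallyEq ?_
        filter_upwards [Ioi_mem_nhds hx] with z hz using indicator_of_mem hz _
    push_cast
    refine contDiff_succ_iff_deriv.2 ⟨fun x => (hd x).differentiableAt, by simp, ?_⟩
    rw [funext fun x => (hd x).deriv]
    exact ih hB.deriv_infty fun k hk => by
      rw [← iteratedDeriv_succ']; exact h0 _ (by omega)

theorem abs_rpow_mul_abs_rpow_neg {y : ℝ} (hy : y ≠ 0) (a : ℝ) (z : ℂ) :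
    ((|y| ^ a : ℝ) : ℂ) * (((|y| ^ (-a) : ℝ) : ℂ) * z) = z := by
  rw [← mul_assoc, ← Complex.ofReal_mul, ← Real.rpow_add (abs_pos.2 hy), add_neg_cancel,
    Real.rpow_zero, Complex.ofReal_one, one_mul]

/-- The Fourier transforms of elements of `I_d` are the sums of a Schwartz function and of a
function supported on the right half-line vanishing to order `d` at `0`. -/
theorem exists_memI_fourierHat_eq_iff {d : ℕ} (hd : 0 < d) (G : ℝ → ℂ) :
    (∃ φ, MemI d φ ∧ ∀ y, y ≠ 0 → fourierHat φ y = G y) ↔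
      ∃ (S : 𝓢(ℝ, ℂ)) (B : ℝ → ℂ), ContDiff ℝ ∞ B ∧ HasCompactSupport B ∧
        (∀ k < d, iteratedDeriv k B 0 = 0) ∧ ∀ y, y ≠ 0 → G y = S y + (Ioi 0).indicator B y := by
  let c : ℂ := (((2 * Real.pi) ^ (-(1 : ℝ) / 2) : ℝ) : ℂ) * (2 * Real.pi)
  have hc0 : c ≠ 0 := mul_ne_zero two_pi_rpow_ne_zero (by exact_mod_cast Real.two_pi_pos.ne')
  have key : ∀ (s : 𝓢(ℝ, ℂ)) (B : ℝ → ℂ), ContDiff ℝ ∞ B → HasCompactSupport B →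
      (∀ k < d, iteratedDeriv k B 0 = 0) → ∀ y,
      fourierHat (fun x => s x + halfFourier B x) y =
        fourierHat s y + c * (Ioi 0).indicator B y := fun s B hB hc h0 y => by
    rw [fourierHat_add (memI_schwartz d s |>.integrable hd)
      ((memI_halfFourier hB hc d h0).integrable hd),
      fourierHat_halfFourier hB hc (by simpa using h0 0 hd)]
  have hmul : ∀ (a : ℂ) (B : ℝ → ℂ), ContDiff ℝ ∞ B → HasCompactSupport B →
      (∀ k < d, iteratedDeriv k B 0 = 0) → ContDiff ℝ ∞ (fun y => a * B y) ∧
      HasCompactSupport (fun y => a * B y) ∧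
      (∀ k < d, iteratedDeriv k (fun y => a * B y) 0 = 0) := fun a B hB hc h0 =>
    ⟨contDiff_const.mul hB, hc.mul_left, fun k hk => by
      rw [iteratedDeriv_const_mul_field, h0 k hk, mul_zero]⟩
  constructor
  · rintro ⟨φ, hφ, hG⟩
    obtain ⟨s, B, hB, hc, h0, he⟩ := hφ.exists_decomposition
    obtain ⟨S, hS⟩ := exists_schwartz_eq_fourierHat s
    obtain ⟨h1, h2, h3⟩ := hmul c B hB hc h0
    refine ⟨S, fun y => c * B y, h1, h2, h3, fun y hy => ?_⟩
    rw [← hG y hy, funext he, key s B hB hc h0, hS, indicator_const_mul]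
  · rintro ⟨S, B, hB, hc, h0, he⟩
    obtain ⟨s, hs⟩ := exists_schwartz_fourierHat_eq S
    obtain ⟨h1, h2, h3⟩ := hmul c⁻¹ B hB hc h0
    refine ⟨fun x => s x + halfFourier (fun y => c⁻¹ * B y) x,
      (memI_schwartz d s).add (memI_halfFourier h1 h2 d h3), fun y hy => ?_⟩
    rw [key s _ h1 h2 h3, hs, he y hy, indicator_const_mul, mul_inv_cancel_left₀ hc0]

theorem iteratedDeriv_zero_eq_of_eqOn {g P : ℝ → ℂ} {n k : ℕ} (hg : ContDiff ℝ n g)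
    (hP : ContDiff ℝ ∞ P) (hk : k ≤ n) {s : Set ℝ} (hs : IsOpen s) (h0 : 0 ∈ closure s)
    (h : EqOn g P s) : iteratedDeriv k g 0 = iteratedDeriv k P 0 := by
  have h1 : EqOn (iteratedDeriv k g) (iteratedDeriv k P) s := fun y hy =>
    EventuallyEq.iteratedDeriv_eq k (h.eventuallyEq_of_mem (hs.mem_nhds hy))
  exact h1.closure (hg.continuous_iteratedDeriv k (by exact_mod_cast hk))
    (hP.iteratedDeriv_infty k).continuous h0

/-- A function satisfying the smoothness and decay conditions is the sum of a Schwartz function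
and of a function supported on the right half-line vanishing to order `d` at `0`. -/
theorem exists_schwartz_add_indicator {d : ℕ} (hd : 0 < d) {G P Q g : ℝ → ℂ}
    (hG : SmoothOffZero G) (hr : RapidlyDecreasing G)
    (hP : ContDiff ℝ ∞ P) (hPG : ∀ y : ℝ, 0 < y → P y = G y)
    (hQ : ContDiff ℝ ∞ Q) (hQG : ∀ y : ℝ, y < 0 → Q y = G y)
    (hg : ContDiff ℝ (d - 1 : ℕ) g) (hgG : ∀ y, y ≠ 0 → g y = G y) :
    ∃ (S : 𝓢(ℝ, ℂ)) (B : ℝ → ℂ), ContDiff ℝ ∞ B ∧ HasCompactSupport B ∧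
      (∀ k < d, iteratedDeriv k B 0 = 0) ∧ ∀ y, y ≠ 0 → G y = S y + (Ioi 0).indicator B y := by
  have hgP : EqOn g P (Ioi 0) := fun y hy => by
    rw [hgG y (ne_of_gt hy), hPG y hy]
  have hgQ : EqOn g Q (Iio 0) := fun y hy => by
    rw [hgG y (ne_of_lt hy), hQG y hy]
  have hP0 : ∀ k < d, iteratedDeriv k g 0 = iteratedDeriv k P 0 := fun k hk =>
    iteratedDeriv_zero_eq_of_eqOn hg hP (by omega) isOpen_Ioi (by simp) hgP
  have hQ0 : ∀ k < d, iteratedDeriv k g 0 = iteratedDeriv k Q 0 := fun k hk =>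
    iteratedDeriv_zero_eq_of_eqOn hg hQ (by omega) isOpen_Iio (by simp) hgQ
  let χ : ContDiffBump (0 : ℝ) := ⟨1 / 4, 1 / 2, by norm_num, by norm_num⟩
  let B : ℝ → ℂ := fun y => ((χ y : ℝ) : ℂ) * (P y - Q y)
  have hB : ContDiff ℝ ∞ B :=
    (Complex.ofRealCLM.contDiff.comp χ.contDiff).mul (hP.sub hQ)
  have hc : HasCompactSupport B :=
    (χ.hasCompactSupport.comp_left Complex.ofReal_zero).mul_right
  have hB1 : B =ᶠ[𝓝 0] P - Q := by
    filter_upwards [χ.eventuallyEq_one] with y hy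
    simp [B, hy]
  have hB0 : ∀ k < d, iteratedDeriv k B 0 = 0 := fun k hk => by
    have hk' : ((k : ℕ) : WithTop ℕ∞) ≤ ∞ := by exact_mod_cast le_top
    rw [hB1.iteratedDeriv_eq, iteratedDeriv_sub (hP.of_le hk').contDiffAt
      (hQ.of_le hk').contDiffAt, ← hP0 k hk, ← hQ0 k hk, sub_self]
  have hBfar : ∀ y : ℝ, 1 / 2 < |y| → B y = 0 := fun y hy => by
    have : χ y = 0 := χ.zero_of_le_dist (by rw [Real.dist_0_eq_abs]; exact hy.le)
    simp [B, this]
  let T : ℝ → ℂ := fun y => g y - (Ioi 0).indicator B y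
  have hTG : ∀ y, y ≠ 0 → T y = G y + (Ioi 0).indicator (fun y => -1 * B y) y := fun y hy => by
    simp only [T]
    rw [hgG y hy, indicator_const_mul]; ring
  have hT : ContDiff ℝ ∞ T := by
    refine contDiff_iff_contDiffAt.2 fun y => ?_
    by_cases hy : y = 0
    · subst hy
      refine hQ.contDiffAt.congr_of_eventuallyEq ?_
      filter_upwards [hB1] with y hy
      rcases lt_trichotomy y 0 with h | rfl | h
      · simp only [T]
        rw [indicator_of_notMem (by simpa using h.le), sub_zero, hgQ h]
      · simpa [T] using hQ0 0 hd
      · simp only [T]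
        rw [indicator_of_mem (mem_Ioi.2 h), hy, hgP h]; simp
    · exact (hG.add (ContDiff.smoothOffZero_indicator (contDiff_const.mul hB))).congr hTG y hy
  have hTr : RapidlyDecreasing T := hr.congr fun y hy => by
    rw [hTG y (abs_pos.1 (by linarith)), indicator_const_mul, indicator_apply, hBfar y hy]
    simp
  obtain ⟨S, hS⟩ := exists_schwartz_coe_eq hT hTr
  exact ⟨S, B, hB, hc, hB0, fun y hy => by rw [hS, ← hgG y hy]; simp [T]⟩

/-- description of the Kirillov space: `S̃_d` is exactly the set of
functions `f`, smooth on `ℝ ∖ {0}`, such that (i) `f` and all its derivatives are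
rapidly decreasing at `±∞`; (ii) `y ↦ |y|^{(d-1)/2} f(y)` is smooth on the right and on
the left at `y = 0`; (iii) `y ↦ |y|^{(d-1)/2} f(y)` extends to a `C^{d-1}` function
on `ℝ`. -/
theorem Stilde_description (d : ℕ) (hd : 0 < d) (f : ℝ → ℂ) :
    MemStilde d f ↔
      (∀ y : ℝ, y ≠ 0 → ContDiffAt ℝ (⊤ : ℕ∞) f y) ∧
      (∀ m n : ℕ, ∃ C : ℝ, ∀ y : ℝ, 1 ≤ |y| → |y| ^ m * ‖iteratedDeriv n f y‖ ≤ C) ∧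
      (∃ g : ℝ → ℂ, ContDiff ℝ (⊤ : ℕ∞) g ∧
        ∀ y : ℝ, 0 < y → g y = ((|y| ^ (((d : ℝ) - 1) / 2) : ℝ) : ℂ) * f y) ∧
      (∃ g : ℝ → ℂ, ContDiff ℝ (⊤ : ℕ∞) g ∧
        ∀ y : ℝ, y < 0 → g y = ((|y| ^ (((d : ℝ) - 1) / 2) : ℝ) : ℂ) * f y) ∧
      ∃ g : ℝ → ℂ, ContDiff ℝ (d - 1 : ℕ) g ∧
        ∀ y : ℝ, y ≠ 0 → g y = ((|y| ^ (((d : ℝ) - 1) / 2) : ℝ) : ℂ) * f y := by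
  have hneg : -(((d : ℝ) - 1) / 2) = (1 - (d : ℝ)) / 2 := by ring
  have hmem : MemStilde d f ↔ ∃ φ, MemI d φ ∧ ∀ y : ℝ, y ≠ 0 →
      fourierHat φ y = ((|y| ^ (((d : ℝ) - 1) / 2) : ℝ) : ℂ) * f y := by
    refine exists_congr fun φ => and_congr_right fun _ => forall₂_congr fun y hy => ?_
    constructor <;> intro h
    · rw [h, Md, ← hneg, abs_rpow_mul_abs_rpow_neg hy]
    · have := abs_rpow_mul_abs_rpow_neg hy (-(((d : ℝ) - 1) / 2)) (f y)
      rw [Md, h, ← hneg]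
      rwa [neg_neg, eq_comm] at this
  rw [hmem, exists_memI_fourierHat_eq_iff hd]
  constructor
  · rintro ⟨S, B, hB, hc, h0, hG⟩
    have hSs : SmoothOffZero S := (S.smooth ⊤).smoothOffZero
    have hf : ∀ y, y ≠ 0 → f y = ((|y| ^ (-(((d : ℝ) - 1) / 2)) : ℝ) : ℂ) *
        (S y + (Ioi 0).indicator B y) := fun y hy => by
      rw [← hG y hy]
      have := abs_rpow_mul_abs_rpow_neg hy (-(((d : ℝ) - 1) / 2)) (f y)
      rwa [neg_neg, eq_comm] at this
    have hs := hSs.add hB.smoothOffZero_indicator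
    have hr := S.rapidlyDecreasing.add (hc.rapidlyDecreasing_indicator hB) hSs
      hB.smoothOffZero_indicator
    refine ⟨(hs.rpow_mul _).congr hf,
      (hr.rpow_mul hs _).congr fun y hy => hf y (abs_pos.1 (by linarith)),
      ⟨fun y => S y + B y, (S.smooth ⊤).add hB, fun y hy => ?_⟩,
      ⟨S, S.smooth ⊤, fun y hy => ?_⟩,
      ⟨fun y => S y + (Ioi 0).indicator B y,
        (contDiff_infty.1 (S.smooth ⊤) (d - 1)).add
          (contDiff_indicator_Ioi hB fun k hk => h0 k (by omega)), fun y hy => (hG y hy).symm⟩⟩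
    · rw [hG y hy.ne', indicator_of_mem (mem_Ioi.2 hy)]
    · rw [hG y hy.ne, indicator_of_notMem (by simpa using hy.le), add_zero]
  · rintro ⟨hs, hr, ⟨P, hP, hPG⟩, ⟨Q, hQ, hQG⟩, g, hg, hgG⟩
    exact exists_schwartz_add_indicator hd (SmoothOffZero.rpow_mul hs _)
      (RapidlyDecreasing.rpow_mul hr hs _) hP hPG hQ hQG hg hgG
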